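/- Given a recollement of compactly generated triangulated categories T' → T → T'' (with the six functors i^*, i_*, i^!, j_!, j^*, j_*), the following are equivalent: (i) i_* preserves compact objects; (ii) j^* preserves compact objects; (iii) i^! has a right adjoint; (iv) j_* has a right adjoint; (v) the recollement extends one step downwards. -/

import Mathlib

open CategoryTheory Limits Pretriangulated

universe w v u

namespace Paper

section Summands

variable {C : Type*} {D : Type*} [Category C] [Category D]

/-- Every object of the target is a direct summand (retract) of an object in the image. -/
def DenseUpToSummands (F : C ⥤ D) : Prop :=
  ∀ X : D, ∃ (A : C) (s : X ⟶ F.obj A) (r : F.obj A ⟶ X), s ≫ r = 𝟙 X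

/-- A functor is an equivalence up to direct summands if it is fully faithful and
every object of the target is a direct summand of an object in its image. -/
structure IsEquivalenceUpToSummands (F : C ⥤ D) : Prop where
  full : F.Full
  faithful : F.Faithful
  dense : DenseUpToSummands F

end Summands

section Compact

variable {T : Type u} [Category.{v} T] [Preadditive T]

/-- An object `X` is compact if, for every set-indexed family with a coproduct, the
canonical map `⨁ᵢ Hom(X, Yᵢ) → Hom(X, ∐ᵢ Yᵢ)` is bijective. -/
def IsCompactObj (X : T) : Prop :=
  ∀ (ι : Type v) [DecidableEq ι], ∀ (g : ι → T) (c : Cofan g) (_ : IsColimit c),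
    Function.Bijective (DirectSum.toAddMonoid
      (fun i => AddMonoidHom.mk' (fun u : X ⟶ g i => u ≫ c.inj i)
        (fun _ _ => Preadditive.add_comp _ _ _ _ _ _)))

variable (T) in
/-- A triangulated category with small coproducts is compactly generated if there is a
set of compact objects such that any object receiving no nonzero maps from their shifts
is zero. -/
def IsCompactlyGenerated [HasShift T ℤ] : Prop :=
  ∃ (ι : Type v) (g : ι → T), (∀ i, IsCompactObj (g i)) ∧
    ∀ X : T, (∀ (i : ι) (n : ℤ) (f : g i ⟶ X⟦n⟧), f = 0) → IsZero X

/-- `a` is a compact generator. -/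
def IsCompactGenerator [HasShift T ℤ] (a : T) : Prop :=
  IsCompactObj a ∧ ∀ X : T, (∀ (n : ℤ) (f : a ⟶ X⟦n⟧), f = 0) → IsZero X

end Compact

section Rec

variable (T' T T'' : Type*)
  [Category T'] [HasZeroObject T'] [HasShift T' ℤ] [Preadditive T']
  [∀ n : ℤ, (shiftFunctor T' n).Additive] [Pretriangulated T']
  [Category T] [HasZeroObject T] [HasShift T ℤ] [Preadditive T]
  [∀ n : ℤ, (shiftFunctor T n).Additive] [Pretriangulated T]
  [Category T''] [HasZeroObject T''] [HasShift T'' ℤ] [Preadditive T'']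
  [∀ n : ℤ, (shiftFunctor T'' n).Additive] [Pretriangulated T'']

/-- A recollement of `T` in terms of `T'` and `T''` (Beilinson–Bernstein–Deligne):
six triangle functors forming two adjoint triples `(i^*, i_*, i^!)` and `(j_!, j^*, j_*)`,
with `i_*`, `j_!`, `j_*` fully faithful, `j^* ∘ i_* = 0`, and for each `X` the two gluing
distinguished triangles `i_* i^! X → X → j_* j^* X →` and `j_! j^* X → X → i_* i^* X →`
(whose first two maps are the relevant counits and units). -/
structure Recollement where
  iStar : T ⥤ T'
  iS : T' ⥤ T
  iShriek : T ⥤ T'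
  jShriek : T'' ⥤ T
  jStar : T ⥤ T''
  jS : T'' ⥤ T
  commShift_iStar : iStar.CommShift ℤ
  isTriangulated_iStar : letI := commShift_iStar; iStar.IsTriangulated
  commShift_iS : iS.CommShift ℤ
  isTriangulated_iS : letI := commShift_iS; iS.IsTriangulated
  commShift_iShriek : iShriek.CommShift ℤ
  isTriangulated_iShriek : letI := commShift_iShriek; iShriek.IsTriangulated
  commShift_jShriek : jShriek.CommShift ℤ
  isTriangulated_jShriek : letI := commShift_jShriek; jShriek.IsTriangulated
  commShift_jStar : jStar.CommShift ℤ
  isTriangulated_jStar : letI := commShift_jStar; jStar.IsTriangulated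
  commShift_jS : jS.CommShift ℤ
  isTriangulated_jS : letI := commShift_jS; jS.IsTriangulated
  adj₁ : iStar ⊣ iS
  adj₂ : iS ⊣ iShriek
  adj₃ : jShriek ⊣ jStar
  adj₄ : jStar ⊣ jS
  iS_full : iS.Full
  iS_faithful : iS.Faithful
  jShriek_full : jShriek.Full
  jShriek_faithful : jShriek.Faithful
  jS_full : jS.Full
  jS_faithful : jS.Faithful
  zero : ∀ X : T', IsZero (jStar.obj (iS.obj X))
  tri₁ : ∀ X : T, ∃ h : jS.obj (jStar.obj X) ⟶ (iS.obj (iShriek.obj X))⟦(1 : ℤ)⟧,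
    Triangle.mk (adj₂.counit.app X) (adj₄.unit.app X) h ∈ distTriang T
  tri₂ : ∀ X : T, ∃ h : iS.obj (iStar.obj X) ⟶ (jShriek.obj (jStar.obj X))⟦(1 : ℤ)⟧,
    Triangle.mk (adj₃.counit.app X) (adj₁.unit.app X) h ∈ distTriang T

end Rec

section Helpers

/-- Preservation of small coproducts, in unbundled form. -/
def PresCop {T : Type*} [Category.{v} T] {S : Type*} [Category.{v} S] (F : T ⥤ S) : Prop :=
  ∀ (ι : Type v) (g : ι → T) (c : Cofan g), IsColimit c →
    Nonempty (IsColimit (Cofan.mk (F.obj c.pt) (fun i => F.map (c.inj i))))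

lemma presCop_of_preserves {T : Type*} [Category.{v} T] {S : Type*} [Category.{v} S] (F : T ⥤ S)
    [∀ ι : Type v, PreservesColimitsOfShape (Discrete ι) F] : PresCop F := by
  intro ι g c hc
  exact ⟨(Cofan.isColimitMapCoconeEquiv F g c).toFun (isColimitOfPreserves F hc)⟩

lemma presCop_of_isLeftAdjoint {T : Type*} [Category.{v} T] {S : Type*} [Category.{v} S] (F : T ⥤ S)
    [F.IsLeftAdjoint] : PresCop F := by
  have : PreservesColimitsOfSize.{v, v} F :=
    (Adjunction.ofIsLeftAdjoint F).leftAdjoint_preservesColimits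
  exact presCop_of_preserves F

section Additive

variable {T : Type*} [Category.{v} T] [Preadditive T]

/-- Projections from a coproduct. -/
noncomputable def coproj {ι : Type v} {g : ι → T} {c : Cofan g} (hc : IsColimit c) (i : ι) :
    c.pt ⟶ g i := by
  classical
  exact Cofan.IsColimit.desc hc (fun j => if h : j = i then eqToHom (by rw [h]) else 0)

lemma inj_coproj_self {ι : Type v} {g : ι → T} {c : Cofan g} (hc : IsColimit c) (i : ι) :
    c.inj i ≫ coproj hc i = 𝟙 _ := by
  simp [coproj, Cofan.IsColimit.fac]

lemma inj_coproj_ne {ι : Type v} {g : ι → T} {c : Cofan g} (hc : IsColimit c) {i j : ι}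
    (h : j ≠ i) : c.inj j ≫ coproj hc i = 0 := by
  simp [coproj, Cofan.IsColimit.fac, h]

/-- Practical form of compactness. -/
def Cpt (X : T) : Prop :=
  ∀ (ι : Type v) (g : ι → T) (c : Cofan g) (hc : IsColimit c) (f : X ⟶ c.pt),
    ∃ s : Finset ι, f = ∑ i ∈ s, (f ≫ coproj hc i) ≫ c.inj i

lemma sum_coproj {ι : Type v} {g : ι → T} {c : Cofan g} (hc : IsColimit c) {X : T} (s : Finset ι)
    (u : ∀ i, X ⟶ g i) (j : ι) (hj : j ∈ s) :
    (∑ i ∈ s, u i ≫ c.inj i) ≫ coproj hc j = u j := by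
  rw [Preadditive.sum_comp, Finset.sum_eq_single j]
  · rw [Category.assoc, inj_coproj_self, Category.comp_id]
  · intro b _ hb
    rw [Category.assoc, inj_coproj_ne hc hb, comp_zero]
  · intro h; exact absurd hj h

lemma cpt_of_sum {X : T}
    (h : ∀ (ι : Type v) (g : ι → T) (c : Cofan g) (_ : IsColimit c) (f : X ⟶ c.pt),
      ∃ (s : Finset ι) (u : ∀ i, X ⟶ g i), f = ∑ i ∈ s, u i ≫ c.inj i) : Cpt X := by
  intro ι g c hc f
  obtain ⟨s, u, rfl⟩ := h ι g c hc f
  refine ⟨s, Finset.sum_congr rfl fun i hi => ?_⟩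
  rw [sum_coproj hc s u i hi]

lemma toAddMonoid_eq_sum {X : T} {ι : Type v} [DecidableEq ι] {g : ι → T} (c : Cofan g)
    [∀ (i : ι) (x : X ⟶ g i), Decidable (x ≠ 0)] (d : DirectSum ι (fun i => X ⟶ g i)) :
    DirectSum.toAddMonoid (fun i => AddMonoidHom.mk' (fun u : X ⟶ g i => u ≫ c.inj i)
        (fun _ _ => Preadditive.add_comp _ _ _ _ _ _)) d =
      ∑ i ∈ DFinsupp.support d, d i ≫ c.inj i := by
  conv_lhs => rw [← DirectSum.sum_support_of d, map_sum]
  refine Finset.sum_congr rfl fun i _ => ?_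
  rw [DirectSum.toAddMonoid_of]
  rfl

lemma isCompactObj_iff {T : Type u} [Category.{v} T] [Preadditive T] (X : T) :
    IsCompactObj X ↔ Cpt X := by
  constructor
  · intro h
    classical
    apply cpt_of_sum
    intro ι g c hc f
    obtain ⟨d, hd⟩ := (h ι g c hc).2 f
    refine ⟨DFinsupp.support d, fun i => d i, ?_⟩
    rw [← hd, toAddMonoid_eq_sum]
  · intro h ι _ g c hc
    constructor
    · rw [injective_iff_map_eq_zero]
      intro d hd
      have : ∀ (i : ι) (x : X ⟶ g i), Decidable (x ≠ 0) := fun _ _ => Classical.dec _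
      refine DFinsupp.ext fun i => ?_
      by_contra hne
      have hi : i ∈ DFinsupp.support d := by simpa using hne
      have := sum_coproj hc (DFinsupp.support d) (fun i => d i) i hi
      rw [toAddMonoid_eq_sum] at hd
      rw [hd, zero_comp] at this
      exact hne this.symm
    · intro f
      obtain ⟨s, hs⟩ := h ι g c hc f
      refine ⟨∑ i ∈ s, DirectSum.of (fun i => X ⟶ g i) i (f ≫ coproj hc i), ?_⟩
      rw [map_sum]
      conv_rhs => rw [hs]
      refine Finset.sum_congr rfl fun i _ => ?_
      rw [DirectSum.toAddMonoid_of]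
      rfl

/-- A left adjoint whose right adjoint preserves coproducts preserves compacts. -/
lemma cpt_of_adj {S : Type*} [Category.{v} S] [Preadditive S] {F : T ⥤ S} {G : S ⥤ T}
    [F.Additive] (adj : F ⊣ G) (hG : PresCop G) {X : T} (hX : Cpt X) : Cpt (F.obj X) := by
  apply cpt_of_sum
  intro ι g c hc f
  obtain ⟨hc'⟩ := hG ι g c hc
  obtain ⟨s, hs⟩ := hX ι _ _ hc' (adj.homEquiv _ _ f)
  refine ⟨s, fun i => (adj.homEquiv _ _).symm (adj.homEquiv _ _ f ≫ coproj hc' i), ?_⟩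
  have h1 : f = (adj.homEquiv _ _).symm (adj.homEquiv _ _ f) := by simp
  conv_lhs => rw [h1, hs]
  simp only [Adjunction.homEquiv_counit, Functor.map_sum, Preadditive.sum_comp]
  refine Finset.sum_congr rfl fun i _ => ?_
  rw [Functor.map_comp, Category.assoc, Category.assoc]
  congr 1
  exact adj.counit.naturality (c.inj i)

lemma cpt_of_iso {X Y : T} (e : X ≅ Y) (hX : Cpt X) : Cpt Y := by
  apply cpt_of_sum
  intro ι g c hc f
  obtain ⟨s, hs⟩ := hX ι g c hc (e.hom ≫ f)
  refine ⟨s, fun i => e.inv ≫ (e.hom ≫ f) ≫ coproj hc i, ?_⟩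
  have h1 : f = e.inv ≫ e.hom ≫ f := by simp
  conv_lhs => rw [h1, hs]
  simp [Preadditive.comp_sum]

end Additive

lemma isColimit_of_isIso {T : Type*} [Category.{v} T] {ι : Type v} {g : ι → T} {c c' : Cofan g}
    (hc : IsColimit c) (d : c.pt ⟶ c'.pt) (hd : ∀ i, c.inj i ≫ d = c'.inj i) [IsIso d] :
    Nonempty (IsColimit c') :=
  ⟨IsColimit.ofIsoColimit hc (Cofan.ext (asIso d) hd)⟩

lemma isIso_of_isColimit {T : Type*} [Category.{v} T] {ι : Type v} {g : ι → T} {c c' : Cofan g}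
    (hc : IsColimit c) (hc' : IsColimit c') (d : c.pt ⟶ c'.pt)
    (hd : ∀ i, c.inj i ≫ d = c'.inj i) : IsIso d := by
  have : d = (hc.coconePointUniqueUpToIso hc').hom := by
    apply Cofan.IsColimit.hom_ext hc
    intro i
    rw [hd]
    exact (IsColimit.comp_coconePointUniqueUpToIso_hom hc hc' ⟨i⟩).symm
  rw [this]
  infer_instance

lemma isLeftAdjoint_of_univ {T : Type*} [Category.{v} T] {S : Type*} [Category.{v} S] (F : T ⥤ S)
    (h : ∀ Y : S, ∃ (X : T) (x : F.obj X ⟶ Y), ∀ Z : T,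
      Function.Bijective (fun φ : Z ⟶ X => F.map φ ≫ x)) : F.IsLeftAdjoint := by
  have : ∀ Y, HasTerminal (CostructuredArrow F Y) := by
    intro Y
    obtain ⟨X, x, hx⟩ := h Y
    refine IsTerminal.hasTerminal (X := CostructuredArrow.mk x) ?_
    refine IsTerminal.ofUniqueHom
      (fun Z => CostructuredArrow.homMk ((hx Z.left).2 Z.hom).choose
        ((hx Z.left).2 Z.hom).choose_spec) ?_
    intro Z m
    apply CostructuredArrow.hom_ext
    apply (hx Z.left).1
    simp only [CostructuredArrow.homMk_left]
    exact (CostructuredArrow.w m).trans ((hx Z.left).2 Z.hom).choose_spec.symm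
  exact isLeftAdjoint_of_costructuredArrowTerminals F

end Helpers
section Brown

set_option linter.unusedSectionVars false

variable {T : Type*} [Category.{v} T] [HasZeroObject T] [HasShift T ℤ] [Preadditive T]
    [∀ n : ℤ, (shiftFunctor T n).Additive] [Pretriangulated T]
    {S : Type*} [Category.{v} S] [HasZeroObject S] [HasShift S ℤ] [Preadditive S]
    [∀ n : ℤ, (shiftFunctor S n).Additive] [Pretriangulated S]

lemma presCop_shift (T : Type*) [Category.{v} T] [HasShift T ℤ] (n : ℤ) :
    PresCop (shiftFunctor T n) :=
  presCop_of_isLeftAdjoint _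

lemma seq_zero {T : Type*} [Category.{v} T] [Preadditive T]
    {X : ℕ → T} (f : ∀ n, X n ⟶ X (n + 1))
    (c : Cofan (fun k : ULift.{v} ℕ => X k.down)) (hc : IsColimit c) (d : c.pt ⟶ c.pt)
    (hd : ∀ n, c.inj ⟨n⟩ ≫ d = c.inj ⟨n⟩ - f n ≫ c.inj ⟨n + 1⟩)
    {g : T} (hg : Cpt g) (h : g ⟶ c.pt) (h0 : h ≫ d = 0) : h = 0 := by
  have key : ∀ n : ℕ, h ≫ coproj hc ⟨n⟩ = 0 := by
    intro n
    induction n with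
    | zero =>
      have : d ≫ coproj hc ⟨0⟩ = coproj hc ⟨0⟩ := by
        apply Cofan.IsColimit.hom_ext hc
        rintro ⟨k⟩
        rw [← Category.assoc, hd, Preadditive.sub_comp, Category.assoc,
          inj_coproj_ne hc (i := ⟨0⟩) (j := ⟨k + 1⟩) (by simp), comp_zero, sub_zero]
      rw [← this, ← Category.assoc, h0, zero_comp]
    | succ n ih =>
      have : d ≫ coproj hc ⟨n + 1⟩ = coproj hc ⟨n + 1⟩ - coproj hc ⟨n⟩ ≫ f n := by
        apply Cofan.IsColimit.hom_ext hc
        rintro ⟨k⟩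
        rw [← Category.assoc, hd, Preadditive.sub_comp, Category.assoc, Preadditive.comp_sub]
        congr 1
        by_cases hk : k = n
        · subst hk
          rw [inj_coproj_self, ← Category.assoc, inj_coproj_self, Category.comp_id,
            Category.id_comp]
        · rw [inj_coproj_ne hc (by simpa using hk), ← Category.assoc,
            inj_coproj_ne hc (by simpa using hk), comp_zero, zero_comp]
      have h2 : h ≫ d ≫ coproj hc ⟨n + 1⟩ = 0 := by rw [← Category.assoc, h0, zero_comp]
      rw [this, Preadditive.comp_sub, ← Category.assoc, ih, zero_comp, sub_zero] at h2
      exact h2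
  obtain ⟨s, hs⟩ := hg _ _ c hc h
  rw [hs]
  refine Finset.sum_eq_zero ?_
  rintro ⟨k⟩ _
  rw [key, zero_comp]

/-- Closure conditions for a localizing class of objects. -/
structure Loc (P : T → Prop) : Prop where
  iso : ∀ {X Y : T}, (X ≅ Y) → P X → P Y
  cop : ∀ (ι : Type v) (g : ι → T) (c : Cofan g), IsColimit c → (∀ i, P (g i)) → P c.pt
  cone : ∀ Tr ∈ distTriang T, P Tr.obj₁ → P Tr.obj₂ → P Tr.obj₃

lemma map_exact (F : T ⥤ S) [F.CommShift ℤ] [F.IsTriangulated] {A B C : T} {u : A ⟶ B} {w : B ⟶ C} {δ : C ⟶ A⟦(1 : ℤ)⟧}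
    (hTr : Triangle.mk u w δ ∈ distTriang T)
    {Y : S} (f : F.obj B ⟶ Y) (hf : F.map u ≫ f = 0) :
    ∃ g : F.obj C ⟶ Y, f = F.map w ≫ g :=
  Triangle.yoneda_exact₂ _ (F.map_distinguished _ hTr) f hf

lemma tri_rot {A B C : T} {u : A ⟶ B} {w : B ⟶ C} {δ : C ⟶ A⟦(1 : ℤ)⟧}
    (hTr : Triangle.mk u w δ ∈ distTriang T) : Triangle.mk w δ (-u⟦(1 : ℤ)⟧') ∈ distTriang T :=
  rot_of_distTriang _ hTr

lemma tri_yo2 {A B C : T} {u : A ⟶ B} {w : B ⟶ C} {δ : C ⟶ A⟦(1 : ℤ)⟧}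
    (hTr : Triangle.mk u w δ ∈ distTriang T) {Y : T} (f : B ⟶ Y) (hf : u ≫ f = 0) : ∃ g : C ⟶ Y, f = w ≫ g :=
  Triangle.yoneda_exact₂ _ hTr f hf

lemma tri_yo3 {A B C : T} {u : A ⟶ B} {w : B ⟶ C} {δ : C ⟶ A⟦(1 : ℤ)⟧}
    (hTr : Triangle.mk u w δ ∈ distTriang T) {Y : T} (f : C ⟶ Y) (hf : w ≫ f = 0) : ∃ g : A⟦(1 : ℤ)⟧ ⟶ Y, f = δ ≫ g :=
  Triangle.yoneda_exact₃ _ hTr f hf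

lemma tri_co2 {A B C : T} {u : A ⟶ B} {w : B ⟶ C} {δ : C ⟶ A⟦(1 : ℤ)⟧}
    (hTr : Triangle.mk u w δ ∈ distTriang T) {Y : T} (f : Y ⟶ B) (hf : f ≫ w = 0) : ∃ g : Y ⟶ A, f = g ≫ u :=
  Triangle.coyoneda_exact₂ _ hTr f hf

lemma tri_co3 {A B C : T} {u : A ⟶ B} {w : B ⟶ C} {δ : C ⟶ A⟦(1 : ℤ)⟧}
    (hTr : Triangle.mk u w δ ∈ distTriang T) {Y : T} (f : Y ⟶ C) (hf : f ≫ δ = 0) : ∃ g : Y ⟶ B, f = g ≫ w :=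
  Triangle.coyoneda_exact₃ _ hTr f hf

/-- A stage of the Brown representability construction. -/
structure St (F : T ⥤ S) (Y : S) (P : T → Prop) where
  X : T
  x : F.obj X ⟶ Y
  hX : P X

lemma brown_start [HasCoproducts.{v} T] (F : T ⥤ S) (hF : PresCop F)
    {κ : Type v} (G : κ → T) {P : T → Prop} (hP : Loc P) (hPG : ∀ i, P (G i)) (Y : S) :
    ∃ s : St F Y P, ∀ (i : κ) (y : F.obj (G i) ⟶ Y), ∃ φ : G i ⟶ s.X, F.map φ ≫ s.x = y := by
  let g : (Σ i : κ, (F.obj (G i) ⟶ Y)) → T := fun p => G p.1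
  let c : Cofan g := Cofan.mk _ (Sigma.ι g)
  have hc : IsColimit c := coproductIsCoproduct g
  obtain ⟨hFc⟩ := hF _ g c hc
  refine ⟨⟨c.pt, Cofan.IsColimit.desc hFc (fun p => p.2), hP.cop _ g c hc fun p => hPG _⟩,
    fun i y => ⟨c.inj ⟨i, y⟩, ?_⟩⟩
  exact Cofan.IsColimit.fac hFc (fun p => p.2) ⟨i, y⟩

lemma brown_step [HasCoproducts.{v} T] (F : T ⥤ S) [F.CommShift ℤ] [F.IsTriangulated]
    (hF : PresCop F)
    {κ : Type v} (G : κ → T) {P : T → Prop} (hP : Loc P) (hPG : ∀ i, P (G i)) (Y : S)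
    (s : St F Y P) :
    ∃ (s' : St F Y P) (f : s.X ⟶ s'.X), F.map f ≫ s'.x = s.x ∧
      ∀ (i : κ) (φ : G i ⟶ s.X), F.map φ ≫ s.x = 0 → φ ≫ f = 0 := by
  let g : (Σ i : κ, {φ : G i ⟶ s.X // F.map φ ≫ s.x = 0}) → T := fun p => G p.1
  let c : Cofan g := Cofan.mk _ (Sigma.ι g)
  have hc : IsColimit c := coproductIsCoproduct g
  obtain ⟨hFc⟩ := hF _ g c hc
  let k : c.pt ⟶ s.X := Cofan.IsColimit.desc hc (fun p => p.2.1)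
  have hk : ∀ p, c.inj p ≫ k = p.2.1 := fun p => Cofan.IsColimit.fac hc (fun p => p.2.1) p
  obtain ⟨X', f, δ, hTr⟩ := distinguished_cocone_triangle k
  have h0 : F.map k ≫ s.x = 0 := by
    apply Cofan.IsColimit.hom_ext hFc
    intro p
    change F.map (c.inj p) ≫ _ = F.map (c.inj p) ≫ _
    rw [← Category.assoc, ← F.map_comp, hk, comp_zero]
    exact p.2.2
  obtain ⟨x', hx'⟩ := map_exact F hTr s.x h0
  refine ⟨⟨X', x', hP.cone _ hTr (hP.cop _ g c hc fun p => hPG _) s.hX⟩, f, hx'.symm, ?_⟩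
  intro i φ hφ
  have h1 : k ≫ f = 0 := comp_distTriang_mor_zero₁₂ _ hTr
  have h2 := hk ⟨i, φ, hφ⟩
  change φ ≫ f = 0
  rw [show φ = c.inj ⟨i, φ, hφ⟩ ≫ k from h2.symm, Category.assoc, h1, comp_zero]

lemma brown_aux [HasCoproducts.{v} T] (F : T ⥤ S) [F.CommShift ℤ] [F.IsTriangulated]
    (hF : PresCop F)
    {κ : Type v} (G : κ → T) (hG : ∀ i, Cpt (G i))
    {P : T → Prop} (hP : Loc P) (hPG : ∀ i, P (G i)) (Y : S) :
    ∃ s : St F Y P, ∀ i : κ, Function.Bijective (fun φ : G i ⟶ s.X => F.map φ ≫ s.x) := by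
  obtain ⟨s0, hs0⟩ := brown_start F hF G hP hPG Y
  choose nxt f hf hk using brown_step F hF G hP hPG Y
  let s : ℕ → St F Y P := fun n => Nat.rec s0 (fun _ t => nxt t) n
  let t : ∀ n, (s n).X ⟶ (s (n + 1)).X := fun n => f (s n)
  have ht : ∀ n, F.map (t n) ≫ (s (n + 1)).x = (s n).x := fun n => hf (s n)
  have htk : ∀ n (i : κ) (φ : G i ⟶ (s n).X), F.map φ ≫ (s n).x = 0 → φ ≫ t n = 0 :=
    fun n => hk (s n)
  have hs0' : ∀ (i : κ) (y : F.obj (G i) ⟶ Y), ∃ φ : G i ⟶ (s 0).X, F.map φ ≫ (s 0).x = y := hs0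
  clear_value t
  generalize s = s at *
  let g : ULift.{v} ℕ → T := fun k => (s k.down).X
  let c : Cofan g := Cofan.mk _ (Sigma.ι g)
  have hc : IsColimit c := coproductIsCoproduct g
  clear_value c
  obtain ⟨hFc⟩ := hF _ g c hc
  let d : c.pt ⟶ c.pt := Cofan.IsColimit.desc hc
    (fun k => c.inj k - t k.down ≫ c.inj ⟨k.down + 1⟩)
  have hd : ∀ n : ℕ, c.inj ⟨n⟩ ≫ d = c.inj ⟨n⟩ - t n ≫ c.inj ⟨n + 1⟩ :=
    fun n => Cofan.IsColimit.fac hc _ ⟨n⟩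
  clear_value d
  obtain ⟨X, p, δ, hTr⟩ := distinguished_cocone_triangle d
  let z : F.obj c.pt ⟶ Y := Cofan.IsColimit.desc hFc (fun k => (s k.down).x)
  have hz : ∀ n : ℕ, F.map (c.inj ⟨n⟩) ≫ z = (s n).x :=
    fun n => Cofan.IsColimit.fac hFc (fun k => (s k.down).x) ⟨n⟩
  have hdz : F.map d ≫ z = 0 := by
    apply Cofan.IsColimit.hom_ext hFc
    rintro ⟨n⟩
    change F.map (c.inj _) ≫ _ = F.map (c.inj _) ≫ _
    rw [← Category.assoc, ← F.map_comp, hd, F.map_sub, F.map_comp, Preadditive.sub_comp,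
      Category.assoc, hz, hz, ht, sub_self, comp_zero]
  obtain ⟨x, hx⟩ := map_exact F hTr z hdz
  have hdp : d ≫ p = 0 := comp_distTriang_mor_zero₁₂ _ hTr
  have hcP : P c.pt := hP.cop _ g c hc fun k => (s k.down).hX
  refine ⟨⟨X, x, hP.cone _ hTr hcP hcP⟩, fun i => ⟨?_, ?_⟩⟩
  ·
    suffices ∀ φ : G i ⟶ X, F.map φ ≫ x = 0 → φ = 0 by
      intro φ φ' h
      rw [← sub_eq_zero]
      apply this
      rw [F.map_sub, Preadditive.sub_comp]
      exact sub_eq_zero.2 h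
    intro φ hφ
    have hφδ : φ ≫ δ = 0 := by
      obtain ⟨hc1⟩ := presCop_shift T 1 _ g c hc
      refine seq_zero (X := fun n => ((s n).X)⟦(1 : ℤ)⟧) (fun n => (t n)⟦(1 : ℤ)⟧') _ hc1
        (d⟦(1 : ℤ)⟧') ?_ (hG i) (φ ≫ δ) ?_
      · intro n
        change (c.inj _)⟦(1 : ℤ)⟧' ≫ d⟦(1 : ℤ)⟧' = (c.inj _)⟦(1 : ℤ)⟧' - _ ≫ (c.inj _)⟦(1 : ℤ)⟧'
        rw [← Functor.map_comp, hd, Functor.map_sub, Functor.map_comp]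
      · rw [Category.assoc]
        have : δ ≫ d⟦(1 : ℤ)⟧' = 0 := comp_distTriang_mor_zero₃₁ _ hTr
        rw [this, comp_zero]
    obtain ⟨ψ, hψ⟩ := tri_co3 hTr φ hφδ
    have hstep : ∀ n, c.inj ⟨n⟩ ≫ p = t n ≫ c.inj ⟨n + 1⟩ ≫ p := by
      intro n
      have := congrArg (fun t => t ≫ p) (hd n)
      rw [Category.assoc, hdp, comp_zero, Preadditive.sub_comp, Category.assoc] at this
      exact sub_eq_zero.1 this.symm
    have hpush : ∀ m n (u : G i ⟶ (s n).X), n ≤ m → ∃ u' : G i ⟶ (s m).X,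
        u ≫ c.inj ⟨n⟩ ≫ p = u' ≫ c.inj ⟨m⟩ ≫ p := by
      intro m n u hnm
      induction m, hnm using Nat.le_induction with
      | base => exact ⟨u, rfl⟩
      | succ m _ ih =>
        obtain ⟨u', hu'⟩ := ih
        exact ⟨u' ≫ t m, by rw [hu', hstep, Category.assoc]⟩
    have hfac : ∃ m, ∃ u : G i ⟶ (s m).X, φ = u ≫ c.inj ⟨m⟩ ≫ p := by
      obtain ⟨I, hI⟩ := hG i _ g c hc ψ
      obtain ⟨m, hm⟩ : ∃ m : ℕ, ∀ k ∈ I, k.down ≤ m :=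
        ⟨I.sup ULift.down, fun k hk => Finset.le_sup (f := ULift.down) hk⟩
      choose! U hU using hpush m
      refine ⟨m, ∑ k ∈ I, U k.down (ψ ≫ coproj hc k), ?_⟩
      rw [hψ]
      conv_lhs => rw [hI]
      rw [Preadditive.sum_comp, Preadditive.sum_comp]
      refine Finset.sum_congr rfl fun k hk => ?_
      rw [← hU _ _ (hm k hk), Category.assoc]
    obtain ⟨m, u, hu⟩ := hfac
    have : F.map u ≫ (s m).x = 0 := by
      rw [← hz, hx, ← hφ, hu]
      simp
    rw [hu, hstep, ← Category.assoc, htk m i u this, zero_comp]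
  · intro y
    obtain ⟨φ, hφ⟩ := hs0' i y
    refine ⟨φ ≫ c.inj ⟨0⟩ ≫ p, ?_⟩
    change F.map (φ ≫ c.inj ⟨0⟩ ≫ p) ≫ x = y
    rw [F.map_comp, F.map_comp, Category.assoc, Category.assoc, ← hx, hz, hφ]

/-- A shift-stable family of compact objects detecting zero objects. -/
structure Gen {κ : Type v} (G : κ → T) : Prop where
  cpt : ∀ i, Cpt (G i)
  shift : ∀ i (n : ℤ), ∃ j, Nonempty ((G i)⟦n⟧ ≅ G j)
  gen : ∀ X : T, (∀ i (f : G i ⟶ X), f = 0) → IsZero X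

lemma exists_gen {T : Type u} [Category.{v} T] [HasZeroObject T] [HasShift T ℤ] [Preadditive T]
    [∀ n : ℤ, (shiftFunctor T n).Additive] [Pretriangulated T] (hT : IsCompactlyGenerated T) :
    ∃ (κ : Type v) (G : κ → T), Gen G := by
  obtain ⟨ι, g, hg, hgen⟩ := hT
  refine ⟨ULift.{v} ℤ × ι, fun p => (g p.2)⟦p.1.down⟧, ?_, ?_, ?_⟩
  · rintro ⟨n, i⟩
    exact cpt_of_adj (F := shiftFunctor T n.down) (shiftEquiv T n.down).toAdjunction
      (presCop_shift T (-n.down)) ((isCompactObj_iff _).1 (hg i))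
  · rintro ⟨n, i⟩ m
    exact ⟨⟨⟨n.down + m⟩, i⟩, ⟨((shiftFunctorAdd T n.down m).app _).symm⟩⟩
  · intro X hX
    apply hgen
    intro i n f
    let e : X⟦n⟧⟦-n⟧ ≅ X := (shiftEquiv T n).unitIso.symm.app X
    have h1 := hX ⟨⟨-n⟩, i⟩ (f⟦-n⟧' ≫ e.hom)
    have h2 : f⟦-n⟧' = 0 := by
      rw [← cancel_mono e.hom, h1, zero_comp]
    apply (shiftFunctor T (-n)).map_injective
    rw [h2, Functor.map_zero]

lemma Gen.isIso {κ : Type v} {G : κ → T} (hG : Gen G) {X Y : T} (x : X ⟶ Y)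
    (h : ∀ i, Function.Bijective (fun φ : G i ⟶ X => φ ≫ x)) : IsIso x := by
  obtain ⟨Z, p, δ, hTr⟩ := distinguished_cocone_triangle x
  refine (Triangle.isZero₃_iff_isIso₁ _ hTr).1 (hG.gen _ ?_)
  intro i f
  change G i ⟶ Z at f
  have hfδ : f ≫ δ = 0 := by
    obtain ⟨j, ⟨e⟩⟩ := hG.shift i (-1)
    let e' : (G i)⟦(-1 : ℤ)⟧⟦(1 : ℤ)⟧ ≅ G i := (shiftEquiv T (1 : ℤ)).counitIso.app (G i)
    obtain ⟨a, ha⟩ := (shiftFunctor T (1 : ℤ)).map_surjective (e'.hom ≫ f ≫ δ)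
    have hax : a ≫ x = 0 := by
      apply (shiftFunctor T (1 : ℤ)).map_injective
      have : δ ≫ x⟦(1 : ℤ)⟧' = 0 := comp_distTriang_mor_zero₃₁ _ hTr
      rw [Functor.map_comp, ha, Category.assoc, Category.assoc, this, comp_zero, comp_zero,
        Functor.map_zero]
    have : e.inv ≫ a = 0 := by
      apply (h j).1
      change (e.inv ≫ a) ≫ x = 0 ≫ x
      rw [Category.assoc, hax, comp_zero, zero_comp]
    have : a = 0 := by rw [← cancel_epi e.inv, this, comp_zero]
    rw [← cancel_epi e'.hom, ← ha, this, Functor.map_zero, comp_zero]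
  obtain ⟨q, hq⟩ := tri_co3 hTr f hfδ
  obtain ⟨r, hr⟩ := (h i).2 q
  have hxp : x ≫ p = 0 := comp_distTriang_mor_zero₁₂ _ hTr
  change r ≫ x = q at hr
  rw [hq, ← hr, Category.assoc, hxp, comp_zero]
  rfl

lemma Gen.induction [HasCoproducts.{v} T] {κ : Type v} {G : κ → T} (hG : Gen G) {P : T → Prop}
    (hP : Loc P) (hPG : ∀ i, P (G i)) (Y : T) : P Y := by
  obtain ⟨s, hs⟩ := brown_aux (𝟭 T) (presCop_of_isLeftAdjoint _) G hG.cpt hP hPG Y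
  have : IsIso (s.x : s.X ⟶ Y) := hG.isIso s.x hs
  exact hP.iso (asIso (s.x : s.X ⟶ Y)) s.hX

/-- The comparison map is bijective at `Z`. -/
def Bij (F : T ⥤ S) {X : T} {Y : S} (x : F.obj X ⟶ Y) (Z : T) : Prop :=
  Function.Bijective (fun φ : Z ⟶ X => F.map φ ≫ x)

lemma bij_iso (F : T ⥤ S) {X : T} {Y : S} (x : F.obj X ⟶ Y) {Z Z' : T} (e : Z ≅ Z')
    (h : Bij F x Z) : Bij F x Z' := by
  constructor
  · intro φ φ' hh
    rw [← cancel_epi e.hom]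
    apply h.1
    dsimp at hh ⊢
    rw [F.map_comp, F.map_comp, Category.assoc, Category.assoc, hh]
  · intro y
    obtain ⟨φ, hφ⟩ := h.2 (F.map e.hom ≫ y)
    refine ⟨e.inv ≫ φ, ?_⟩
    dsimp at hφ ⊢
    rw [F.map_comp, Category.assoc, hφ, ← Category.assoc, ← F.map_comp]
    simp

lemma bij_cop (F : T ⥤ S) (hF : PresCop F) {X : T} {Y : S} (x : F.obj X ⟶ Y)
    {ι : Type v} (g : ι → T) (c : Cofan g) (hc : IsColimit c) (h : ∀ i, Bij F x (g i)) :
    Bij F x c.pt := by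
  obtain ⟨hFc⟩ := hF _ g c hc
  constructor
  · intro φ φ' hh
    apply Cofan.IsColimit.hom_ext hc
    intro i
    apply (h i).1
    dsimp at hh ⊢
    rw [F.map_comp, F.map_comp, Category.assoc, Category.assoc, hh]
  · intro y
    choose u hu using fun i => (h i).2 (F.map (c.inj i) ≫ y)
    refine ⟨Cofan.IsColimit.desc hc u, ?_⟩
    apply Cofan.IsColimit.hom_ext hFc
    intro i
    change F.map (c.inj i) ≫ _ = F.map (c.inj i) ≫ _
    rw [← hu i]
    dsimp
    rw [← Category.assoc, ← F.map_comp, Cofan.IsColimit.fac]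

lemma bij_cone (F : T ⥤ S) [F.CommShift ℤ] [F.IsTriangulated] {X : T} {Y : S} (x : F.obj X ⟶ Y)
    {A B C : T} {u : A ⟶ B} {w : B ⟶ C} {δ : C ⟶ A⟦(1 : ℤ)⟧}
    (hTr : Triangle.mk u w δ ∈ distTriang T) (hA : Bij F x A) (hB : Bij F x B)
    (hA' : Bij F x (A⟦(1 : ℤ)⟧)) (hB' : Bij F x (B⟦(1 : ℤ)⟧)) : Bij F x C := by
  have hR := tri_rot hTr
  have h12 : u ≫ w = 0 := comp_distTriang_mor_zero₁₂ _ hTr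
  have h31 : δ ≫ u⟦(1 : ℤ)⟧' = 0 := comp_distTriang_mor_zero₃₁ _ hTr
  have hRR := tri_rot hR
  constructor
  · suffices ∀ φ : C ⟶ X, F.map φ ≫ x = 0 → φ = 0 by
      intro φ φ' h
      rw [← sub_eq_zero]
      apply this
      rw [F.map_sub, Preadditive.sub_comp]
      exact sub_eq_zero.2 h
    intro φ hφ
    have h1 : w ≫ φ = 0 := by
      apply hB.1
      dsimp
      rw [F.map_comp, Category.assoc, hφ, comp_zero, F.map_zero, zero_comp]
    obtain ⟨χ, hχ⟩ := tri_yo3 hTr φ h1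
    obtain ⟨y, hy⟩ := map_exact F hRR (F.map χ ≫ x) (by
      rw [← Category.assoc, ← F.map_comp, ← hχ, hφ])
    obtain ⟨β, hβ⟩ := hB'.2 y
    have h2 : χ = (-u⟦(1 : ℤ)⟧') ≫ β := by
      apply hA'.1
      dsimp at hβ ⊢
      rw [hy, F.map_comp, Category.assoc, hβ]
    rw [hχ, h2, Preadditive.neg_comp, Preadditive.comp_neg, ← Category.assoc,
      h31, zero_comp, neg_zero]
  · intro y
    obtain ⟨β, hβ⟩ := hB.2 (F.map w ≫ y)
    dsimp at hβ
    have h1 : u ≫ β = 0 := by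
      apply hA.1
      dsimp
      rw [F.map_comp, Category.assoc, hβ, ← Category.assoc, ← F.map_comp,
        h12, F.map_zero, F.map_zero, zero_comp, zero_comp]
    obtain ⟨φ, hφ⟩ := tri_yo2 hTr β h1
    obtain ⟨z, hz⟩ := map_exact F hR (y - F.map φ ≫ x) (by
      rw [Preadditive.comp_sub, ← hβ, hφ, F.map_comp, Category.assoc, sub_self])
    obtain ⟨α, hα⟩ := hA'.2 z
    dsimp at hα
    refine ⟨φ + δ ≫ α, ?_⟩
    dsimp
    rw [F.map_add, Preadditive.add_comp, F.map_comp, Category.assoc, hα, ← hz]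
    abel

theorem brown [HasCoproducts.{v} T] {κ : Type v} {G : κ → T} (hG : Gen G)
    (F : T ⥤ S) [F.CommShift ℤ] [F.IsTriangulated] (hF : PresCop F) : F.IsLeftAdjoint := by
  apply isLeftAdjoint_of_univ
  intro Y
  obtain ⟨s, hs⟩ := brown_aux (P := fun _ => True) F hF G hG.cpt
    ⟨fun _ _ => trivial, fun _ _ _ _ _ => trivial, fun _ _ _ _ => trivial⟩ (fun _ => trivial) Y
  refine ⟨s.X, s.x, fun Z => ?_⟩
  have hloc : Loc (fun Z : T => ∀ n : ℤ, Bij F s.x (Z⟦n⟧)) := by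
    refine ⟨?_, ?_, ?_⟩
    · intro X X' e h n
      exact bij_iso F s.x ((shiftFunctor T n).mapIso e) (h n)
    · intro ι g c hc h n
      obtain ⟨hc'⟩ := presCop_shift T n _ g c hc
      exact bij_cop F hF s.x _ _ hc' (fun i => h i n)
    · intro Tr hTr h1 h2 n
      refine bij_cone F s.x (Triangle.shift_distinguished Tr hTr n) (h1 n) (h2 n) ?_ ?_
      · exact bij_iso F s.x ((shiftFunctorAdd T n 1).app _) (h1 (n + 1))
      · exact bij_iso F s.x ((shiftFunctorAdd T n 1).app _) (h2 (n + 1))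
  have := hG.induction hloc (fun i n => by
    obtain ⟨j, ⟨e⟩⟩ := hG.shift i n
    exact bij_iso F s.x e.symm (hs j)) Z 0
  exact bij_iso F s.x ((shiftFunctorZero T ℤ).app Z) this

/-- If a left adjoint preserves compacts, then its right adjoint preserves coproducts. -/
lemma presCop_of_cpt [HasCoproducts.{v} T] {κ : Type v} {G : κ → T} (hG : Gen G)
    {F : T ⥤ S} {R : S ⥤ T} [F.Additive] [R.Additive] (adj : F ⊣ R)
    (h : ∀ X, Cpt X → Cpt (F.obj X)) : PresCop R := by
  intro ι g c hc
  let g' : ι → T := fun i => R.obj (g i)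
  let c' : Cofan g' := Cofan.mk _ (Sigma.ι g')
  have hc' : IsColimit c' := coproductIsCoproduct g'
  let d : c'.pt ⟶ R.obj c.pt := Cofan.IsColimit.desc hc' (fun i => R.map (c.inj i))
  have hd : ∀ i, c'.inj i ≫ d = R.map (c.inj i) := fun i => Cofan.IsColimit.fac hc' _ i
  clear_value d
  have hπ : ∀ i, d ≫ R.map (coproj hc i) = coproj hc' i := by
    intro i
    apply Cofan.IsColimit.hom_ext hc'
    intro j
    rw [← Category.assoc, hd, ← R.map_comp]
    by_cases hij : j = i
    · subst hij
      rw [inj_coproj_self, inj_coproj_self, R.map_id]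
    · rw [inj_coproj_ne _ hij, inj_coproj_ne _ hij, R.map_zero]
  have : IsIso d := by
    refine hG.isIso d fun k => ⟨?_, ?_⟩
    · intro φ φ' hh
      dsimp at hh
      rw [← sub_eq_zero]
      obtain ⟨s, hs⟩ := hG.cpt k _ _ _ hc' (φ - φ')
      rw [hs]
      refine Finset.sum_eq_zero fun i _ => ?_
      rw [← hπ, Preadditive.sub_comp, ← Category.assoc, ← Category.assoc, hh, sub_self, zero_comp]
    · intro y
      obtain ⟨s, hs⟩ := h _ (hG.cpt k) _ _ _ hc ((adj.homEquiv _ _).symm y)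
      refine ⟨∑ i ∈ s, (adj.homEquiv _ _ ((adj.homEquiv _ _).symm y ≫ coproj hc i)) ≫ c'.inj i, ?_⟩
      dsimp only
      have h1 : y = adj.homEquiv _ _ ((adj.homEquiv _ _).symm y) := by simp
      conv_rhs => rw [h1, hs]
      rw [Preadditive.sum_comp, Adjunction.homEquiv_unit _ _ _ (∑ i ∈ s, _), R.map_sum,
        Preadditive.comp_sum]
      refine Finset.sum_congr rfl fun i _ => ?_
      rw [Category.assoc, hd, ← Adjunction.homEquiv_naturality_right,
        Adjunction.homEquiv_unit]
  exact isColimit_of_isIso hc' d hd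

end Brown
section RecLemmas

variable {T' T T'' : Type u}
    [Category.{v} T'] [HasZeroObject T'] [HasShift T' ℤ] [Preadditive T']
    [∀ n : ℤ, (shiftFunctor T' n).Additive] [Pretriangulated T']
    [Category.{v} T] [HasZeroObject T] [HasShift T ℤ] [Preadditive T]
    [∀ n : ℤ, (shiftFunctor T n).Additive] [Pretriangulated T]
    [Category.{v} T''] [HasZeroObject T''] [HasShift T'' ℤ] [Preadditive T'']
    [∀ n : ℤ, (shiftFunctor T'' n).Additive] [Pretriangulated T'']

lemma rec_hom_zero (R : Recollement T' T T'') {B : T'} {A : T''}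
    (f : R.iS.obj B ⟶ R.jS.obj A) : f = 0 := by
  have h : (R.adj₄.homEquiv _ _).symm f = (R.adj₄.homEquiv _ _).symm 0 :=
    (R.zero B).eq_of_src _ _
  exact (R.adj₄.homEquiv _ _).symm.injective h

lemma rec_iShriek_jS (R : Recollement T' T T'') (A : T'') :
    IsZero (R.iShriek.obj (R.jS.obj A)) := by
  rw [IsZero.iff_id_eq_zero]
  apply (R.adj₂.homEquiv _ _).symm.injective
  rw [rec_hom_zero R ((R.adj₂.homEquiv _ _).symm (𝟙 _)),
    rec_hom_zero R ((R.adj₂.homEquiv _ _).symm 0)]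

lemma isZero_of_cop {C : Type*} [Category.{v} C] [HasZeroObject C] [Preadditive C]
    {ι : Type v} {g : ι → C} {c : Cofan g}
    (hc : IsColimit c) (h : ∀ i, IsZero (g i)) : IsZero c.pt := by
  rw [IsZero.iff_id_eq_zero]
  apply Cofan.IsColimit.hom_ext hc
  intro i
  exact (h i).eq_of_src _ _

lemma rec_jS_presCop [HasCoproducts.{v} T] (R : Recollement T' T T'')
    (h : PresCop R.iShriek) : PresCop R.jS := by
  intro ι g c hc
  letI := R.commShift_iS
  haveI := R.isTriangulated_iS
  haveI := R.jS_full
  haveI := R.jS_faithful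
  let g' : ι → T := fun i => R.jS.obj (g i)
  let c' : Cofan g' := Cofan.mk _ (Sigma.ι g')
  have hc' : IsColimit c' := coproductIsCoproduct g'
  let d : c'.pt ⟶ R.jS.obj c.pt := Cofan.IsColimit.desc hc' (fun i => R.jS.map (c.inj i))
  have hd : ∀ i, c'.inj i ≫ d = R.jS.map (c.inj i) := fun i => Cofan.IsColimit.fac hc' _ i
  clear_value d
  have hz : IsZero (R.iS.obj (R.iShriek.obj c'.pt)) := by
    obtain ⟨hc1⟩ := h _ _ _ hc'
    have := isZero_of_cop hc1 (fun i => rec_iShriek_jS R (g i))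
    exact R.iS.map_isZero this
  have hunit : IsIso (R.adj₄.unit.app c'.pt) := by
    obtain ⟨w, hw⟩ := R.tri₁ c'.pt
    exact (Triangle.isZero₁_iff_isIso₂ _ hw).1 hz
  haveI : R.jStar.IsLeftAdjoint := R.adj₄.isLeftAdjoint
  have hjd : IsIso (R.jStar.map d) := by
    obtain ⟨h1⟩ := presCop_of_isLeftAdjoint R.jStar _ _ _ hc'
    haveI : (R.jS ⋙ R.jStar).IsLeftAdjoint :=
      Functor.isLeftAdjoint_of_iso (asIso R.adj₄.counit).symm
    obtain ⟨h2⟩ := presCop_of_isLeftAdjoint (R.jS ⋙ R.jStar) _ _ _ hc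
    refine isIso_of_isColimit h1 h2 (R.jStar.map d) (fun i => ?_)
    change R.jStar.map (c'.inj i) ≫ R.jStar.map d = R.jStar.map (R.jS.map (c.inj i))
    rw [← Functor.map_comp, hd]
  have : IsIso d := by
    have hn : d ≫ R.adj₄.unit.app (R.jS.obj c.pt) =
        R.adj₄.unit.app c'.pt ≫ R.jS.map (R.jStar.map d) := R.adj₄.unit.naturality d
    have : IsIso (d ≫ R.adj₄.unit.app (R.jS.obj c.pt)) := by
      rw [hn]; infer_instance
    exact IsIso.of_isIso_comp_right d (R.adj₄.unit.app (R.jS.obj c.pt))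
  exact isColimit_of_isIso hc' d hd

lemma rec_iShriek_adj (R : Recollement T' T T'') (h : R.jS.IsLeftAdjoint) :
    R.iShriek.IsLeftAdjoint := by
  letI := R.commShift_iS
  haveI := R.isTriangulated_iS
  letI := R.commShift_jS
  haveI := R.isTriangulated_jS
  haveI := R.jS_full
  haveI := R.jS_faithful
  haveI := R.iS_full
  haveI := R.iS_faithful
  let K := R.jS.rightAdjoint
  let adj : R.jS ⊣ K := Adjunction.ofIsLeftAdjoint R.jS
  apply isLeftAdjoint_of_univ
  intro Y
  let ε : R.jS.obj (K.obj (R.iS.obj Y)) ⟶ R.iS.obj Y := adj.counit.app (R.iS.obj Y)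
  have hε1 : ∀ {A : T''} (q : R.jS.obj A ⟶ R.iS.obj Y),
      ∃ r : R.jS.obj A ⟶ R.jS.obj (K.obj (R.iS.obj Y)), q = r ≫ ε := by
    intro A q
    refine ⟨R.jS.map (adj.homEquiv _ _ q), ?_⟩
    rw [← Adjunction.homEquiv_counit, Equiv.symm_apply_apply]
  have hε2 : ∀ {A : T''} (r : R.jS.obj A ⟶ R.jS.obj (K.obj (R.iS.obj Y))), r ≫ ε = 0 → r = 0 := by
    intro A r hr
    obtain ⟨k, rfl⟩ := R.jS.map_surjective r
    have : k = 0 := by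
      apply (adj.homEquiv _ _).symm.injective
      rw [Adjunction.homEquiv_counit, Adjunction.homEquiv_counit, R.jS.map_zero, zero_comp]
      exact hr
    rw [this, R.jS.map_zero]
  clear_value ε
  obtain ⟨Z, p, δ, hTr⟩ := distinguished_cocone_triangle ε
  have hεp : ε ≫ p = 0 := comp_distTriang_mor_zero₁₂ _ hTr
  have hδε : δ ≫ ε⟦(1 : ℤ)⟧' = 0 := comp_distTriang_mor_zero₃₁ _ hTr
  -- maps from the image of `j_*` to `Z` vanish
  have hjZ : ∀ {A : T''} (f : R.jS.obj A ⟶ Z), f = 0 := by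
    intro A f
    have hfδ : f ≫ δ = 0 := by
      let e : (R.jS.obj (A⟦(-1 : ℤ)⟧))⟦(1 : ℤ)⟧ ≅ R.jS.obj A :=
        ((R.jS.commShiftIso (1 : ℤ)).app (A⟦(-1 : ℤ)⟧)).symm ≪≫
          R.jS.mapIso ((shiftEquiv T'' (1 : ℤ)).counitIso.app A)
      obtain ⟨a, ha⟩ := (shiftFunctor T (1 : ℤ)).map_surjective (e.hom ≫ f ≫ δ)
      have ha0 : a = 0 := by
        apply hε2
        apply (shiftFunctor T (1 : ℤ)).map_injective
        rw [Functor.map_comp, ha, Category.assoc, Category.assoc, hδε, comp_zero, comp_zero,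
          Functor.map_zero]
      rw [← cancel_epi e.hom, ← ha, ha0, Functor.map_zero, comp_zero]
    obtain ⟨q, hq⟩ := tri_co3 hTr f hfδ
    obtain ⟨r, hr⟩ := hε1 q
    rw [hq, hr, Category.assoc, hεp, comp_zero]
  -- maps from the image of `i_*` to `Z` lift uniquely
  have hi1 : ∀ {B : T'} (f : R.iS.obj B ⟶ Z), ∃ b : B ⟶ Y, R.iS.map b ≫ p = f := by
    intro B f
    have hfδ : f ≫ δ = 0 := by
      let e := (R.jS.commShiftIso (1 : ℤ)).app (K.obj (R.iS.obj Y))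
      rw [← cancel_mono e.inv, zero_comp]
      exact rec_hom_zero R _
    obtain ⟨q, hq⟩ := tri_co3 hTr f hfδ
    obtain ⟨b, rfl⟩ := R.iS.map_surjective q
    exact ⟨b, hq.symm⟩
  have hi2 : ∀ {B : T'} (b b' : B ⟶ Y), R.iS.map b ≫ p = R.iS.map b' ≫ p → b = b' := by
    intro B b b' hb
    apply R.iS.map_injective
    rw [← sub_eq_zero]
    obtain ⟨q, hq⟩ := tri_co2 hTr (R.iS.map b - R.iS.map b') (by
      rw [Preadditive.sub_comp, hb, sub_self])
    rw [hq, rec_hom_zero R q, zero_comp]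
  obtain ⟨x, hx⟩ := hi1 (R.adj₂.counit.app Z)
  have key : ∀ {X : T} (φ : X ⟶ Z),
      R.iS.map (R.iShriek.map φ ≫ x) ≫ p = R.adj₂.counit.app X ≫ φ := by
    intro X φ
    rw [Functor.map_comp, Category.assoc, hx]
    exact R.adj₂.counit.naturality φ
  refine ⟨Z, x, fun X => ?_⟩
  obtain ⟨w, hw⟩ := R.tri₁ X
  constructor
  · intro φ φ' hh
    dsimp only at hh
    have h1 : R.adj₂.counit.app X ≫ φ = R.adj₂.counit.app X ≫ φ' := by
      rw [← key, ← key, hh]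
    rw [← sub_eq_zero]
    obtain ⟨q, hq⟩ := tri_yo2 hw (φ - φ') (by
      rw [Preadditive.comp_sub]
      exact sub_eq_zero.2 h1)
    rw [hq, hjZ q, comp_zero]
  · intro ψ
    have hjZ' : ∀ f : (R.jS.obj (R.jStar.obj X))⟦(-1 : ℤ)⟧ ⟶ Z, f = 0 := by
      intro f
      let e := (R.jS.commShiftIso (-1 : ℤ)).app (R.jStar.obj X)
      rw [← cancel_epi e.hom, comp_zero]
      exact hjZ _
    have hext : ∃ φ : X ⟶ Z, R.iS.map ψ ≫ p = R.adj₂.counit.app X ≫ φ := by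
      have hinv := inv_rot_of_distTriang _ hw
      obtain ⟨φ, hφ⟩ := Triangle.yoneda_exact₂ _ hinv (R.iS.map ψ ≫ p) (hjZ' _)
      exact ⟨φ, hφ⟩
    obtain ⟨φ, hφ⟩ := hext
    refine ⟨φ, ?_⟩
    apply hi2
    dsimp only
    rw [key, hφ]

end RecLemmas

/-- For a recollement of compactly generated triangulated categories,
the following are equivalent: (i) `i_*` preserves compact objects; (ii) `j^*` preserves
compact objects; (iii) `i^!` has a right adjoint; (iv) `j_*` has a right adjoint; (v) the
recollement extends one step downwards (both `i^!` and `j_*` have right adjoints). -/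
theorem statement7
    {T' T T'' : Type u}
    [Category.{v} T'] [HasZeroObject T'] [HasShift T' ℤ] [Preadditive T']
    [∀ n : ℤ, (shiftFunctor T' n).Additive] [Pretriangulated T'] [HasCoproducts.{v} T']
    [Category.{v} T] [HasZeroObject T] [HasShift T ℤ] [Preadditive T]
    [∀ n : ℤ, (shiftFunctor T n).Additive] [Pretriangulated T] [HasCoproducts.{v} T]
    [Category.{v} T''] [HasZeroObject T''] [HasShift T'' ℤ] [Preadditive T'']
    [∀ n : ℤ, (shiftFunctor T'' n).Additive] [Pretriangulated T''] [HasCoproducts.{v} T'']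
    (hT' : IsCompactlyGenerated T') (hT : IsCompactlyGenerated T)
    (hT'' : IsCompactlyGenerated T'')
    (R : Recollement T' T T'') :
    [∀ X : T', IsCompactObj X → IsCompactObj (R.iS.obj X),
     ∀ X : T, IsCompactObj X → IsCompactObj (R.jStar.obj X),
     R.iShriek.IsLeftAdjoint,
     R.jS.IsLeftAdjoint,
     R.iShriek.IsLeftAdjoint ∧ R.jS.IsLeftAdjoint].TFAE := by
  letI := R.commShift_iS
  haveI := R.isTriangulated_iS
  letI := R.commShift_iShriek
  haveI := R.isTriangulated_iShriek
  letI := R.commShift_jStar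
  haveI := R.isTriangulated_jStar
  letI := R.commShift_jS
  haveI := R.isTriangulated_jS
  obtain ⟨κ', G', hG'⟩ := exists_gen hT'
  obtain ⟨κ, G, hG⟩ := exists_gen hT
  obtain ⟨κ'', G'', hG''⟩ := exists_gen hT''
  simp only [isCompactObj_iff]
  have h13 : (∀ X : T', Cpt X → Cpt (R.iS.obj X)) → R.iShriek.IsLeftAdjoint := fun h =>
    brown hG R.iShriek (presCop_of_cpt hG' R.adj₂ h)
  have h31 : R.iShriek.IsLeftAdjoint → ∀ X : T', Cpt X → Cpt (R.iS.obj X) := fun h X hX =>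
    cpt_of_adj R.adj₂ (presCop_of_isLeftAdjoint R.iShriek) hX
  have h24 : (∀ X : T, Cpt X → Cpt (R.jStar.obj X)) → R.jS.IsLeftAdjoint := fun h =>
    brown hG'' R.jS (presCop_of_cpt hG R.adj₄ h)
  have h42 : R.jS.IsLeftAdjoint → ∀ X : T, Cpt X → Cpt (R.jStar.obj X) := fun h X hX =>
    cpt_of_adj R.adj₄ (presCop_of_isLeftAdjoint R.jS) hX
  have h34 : R.iShriek.IsLeftAdjoint → R.jS.IsLeftAdjoint := fun h =>
    brown hG'' R.jS (rec_jS_presCop R (presCop_of_isLeftAdjoint R.iShriek))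
  have h43 : R.jS.IsLeftAdjoint → R.iShriek.IsLeftAdjoint := rec_iShriek_adj R
  tfae_have 1 → 3 := h13
  tfae_have 3 → 1 := h31
  tfae_have 2 → 4 := h24
  tfae_have 4 → 2 := h42
  tfae_have 3 → 5 := fun h => ⟨h, h34 h⟩
  tfae_have 5 → 4 := fun h => h.2
  tfae_have 4 → 3 := h43
  tfae_finish

end Paper
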